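/- Let n be even and let p : ZMod n → ℝ² be points with Σ_{k=1}^{n} (−1)^k p_k = 0 (the alternating sum taken over representatives 1, …, n). Then for every point q* ∈ ℝ² there exists exactly one closed polygonal curve q : ZMod n → ℝ² satisfying the midpoint property with respect to p and having q_0 = q*. -/

import Mathlib

noncomputable section

/-- The plane. -/
abbrev E2 := EuclideanSpace ℝ (Fin 2)

/-- A closed polygonal curve `q : ZMod n → E2` satisfies the midpoint property with
respect to `p : ZMod n → E2` if `p k` is the midpoint of `q (k-1)` and `q k` for all `k`. -/
def MidpointProperty (n : ℕ) (p q : ZMod n → E2) : Prop :=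
  ∀ k : ZMod n, p k = midpoint ℝ (q (k - 1)) (q k)

/-- Reflecting a vertex lying before `p (k + 1)` through that point, as a permutation of
pairs (index, vertex). -/
def reflectStep {n : ℕ} (p : ZMod n → E2) : Equiv.Perm (ZMod n × E2) where
  toFun x := (x.1 + 1, (2 : ℝ) • p (x.1 + 1) - x.2)
  invFun x := (x.1 - 1, (2 : ℝ) • p x.1 - x.2)
  left_inv x := by ext <;> simp
  right_inv x := by ext <;> simp

lemma reflectStep_apply {n : ℕ} (p : ZMod n → E2) (x : ZMod n × E2) :
    reflectStep p x = (x.1 + 1, (2 : ℝ) • p (x.1 + 1) - x.2) := rfl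

lemma zpow_apply_of_step {α : Type*} (σ : Equiv.Perm α) (f : ℤ → α)
    (hf : ∀ k, σ (f k) = f (k + 1)) (k : ℤ) : (σ ^ k) (f 0) = f k := by
  induction k with
  | zero => simp
  | succ i ih => rw [add_comm, zpow_add, Equiv.Perm.mul_apply, ih, zpow_one, hf, add_comm]
  | pred i ih =>
    apply σ.injective
    rw [hf, sub_add_cancel, ← ih, ← Equiv.Perm.mul_apply, ← zpow_one_add, add_sub_cancel]

lemma reflectStep_zpow_fst {n : ℕ} (p : ZMod n → E2) (x : E2) (k : ℤ) :
    ((reflectStep p ^ k) (0, x)).1 = k := by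
  have hstep (j : ℤ) : ((reflectStep p ^ (j + 1)) (0, x)).1 =
      ((reflectStep p ^ j) (0, x)).1 + 1 := by
    rw [add_comm, zpow_add, Equiv.Perm.mul_apply, zpow_one, reflectStep_apply]
  induction k with
  | zero => simp
  | succ i ih => rw [hstep, ih]; push_cast; rfl
  | pred i ih =>
    have h := hstep (-(i : ℤ) - 1)
    rw [sub_add_cancel, ih] at h
    rw [← sub_eq_iff_eq_add.mpr h]
    push_cast
    rfl

lemma reflectStep_pow_apply {n : ℕ} (p : ZMod n → E2) (x : E2) (m : ℕ) :
    (reflectStep p ^ m) (0, x) = ((m : ZMod n), (-1 : ℝ) ^ m •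
      (x + (2 : ℝ) • ∑ k ∈ Finset.Icc 1 m, (-1 : ℝ) ^ k • p (k : ZMod n))) := by
  induction m with
  | zero => simp
  | succ m ih =>
    rw [pow_succ', Equiv.Perm.mul_apply, ih, reflectStep_apply,
      Finset.sum_Icc_succ_top (by lia)]
    have h : (-1 : ℝ) ^ m * (-1 : ℝ) ^ m = 1 := by rw [← mul_pow]; simp
    ext1
    · simp
    · push_cast
      match_scalars
      · linear_combination -2 * h
      · ring
      · ring

lemma midpointProperty_iff {n : ℕ} {p q : ZMod n → E2} :
    MidpointProperty n p q ↔ ∀ k, (2 : ℝ) • p (k + 1) - q k = q (k + 1) := by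
  have key (a b c : E2) : a = midpoint ℝ b c ↔ (2 : ℝ) • a - b = c := by
    rw [midpoint_eq_smul_add, invOf_eq_inv, eq_inv_smul_iff₀ two_ne_zero, sub_eq_iff_eq_add']
  simp only [MidpointProperty, key]
  exact ⟨fun h k => by simpa using h (k + 1), fun h k => by simpa using h (k - 1)⟩

theorem stmt3 (n : ℕ) (hn : Even n) (p : ZMod n → E2)
    (hp : ∑ k ∈ Finset.Icc 1 n, ((-1 : ℝ)) ^ k • p (k : ZMod n) = 0) :
    ∀ qstar : E2, ∃! q : ZMod n → E2, MidpointProperty n p q ∧ q 0 = qstar := by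
  intro x
  simp only [midpointProperty_iff]
  have hfix : (reflectStep p ^ (n : ℤ)) (0, x) = (0, x) := by
    rw [zpow_natCast, reflectStep_pow_apply, hp, hn.neg_one_pow]
    simp
  have hper (a b : ℤ) (hab : (a : ZMod n) = b) :
      (reflectStep p ^ a) (0, x) = (reflectStep p ^ b) (0, x) := by
    obtain ⟨c, hc⟩ := (ZMod.intCast_eq_intCast_iff_dvd_sub a b n).mp hab
    rw [eq_add_of_sub_eq' hc, zpow_add, Equiv.Perm.mul_apply, zpow_mul,
      Equiv.Perm.zpow_apply_eq_self_of_apply_eq_self hfix]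
  refine ⟨fun k => ((reflectStep p ^ (k.cast : ℤ)) (0, x)).2, ⟨fun k => ?_, ?_⟩, ?_⟩
  · have h := hper (k + 1 : ZMod n).cast (1 + k.cast) (by simp [add_comm])
    have hk : ((reflectStep p ^ (k.cast : ℤ)) (0, x)).1 = k := by
      rw [reflectStep_zpow_fst, ZMod.intCast_zmod_cast]
    beta_reduce
    rw [h, zpow_add, zpow_one, Equiv.Perm.mul_apply, reflectStep_apply, hk]
  · simp
  · rintro q ⟨hq, rfl⟩
    funext k
    have h := zpow_apply_of_step (reflectStep p) (fun j : ℤ => ((j : ZMod n), q j))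
      (fun j => by simp [reflectStep_apply, hq]) k.cast
    simp only [Int.cast_zero, ZMod.intCast_zmod_cast] at h
    rw [h]
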